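/- Consider the problem with a single quadratic constraint (m = 1): minimize f(x) = (1/2)⟨x, T x⟩ + ⟨c, x⟩ over F = {x ∈ H : (1/2)⟨x, T₁ x⟩ + ⟨c₁, x⟩ + α₁ ≤ 0}. Suppose x ↦ ⟨x, T x⟩ is a Legendre form, F is nonempty, and f is bounded from below on F. Then f attains its infimum on F. -/

import Mathlib

open scoped RealInnerProductSpace
open Filter Topology

/-- A sequence `x` in a real inner product space converges weakly to `x₀` if
`⟪a, x k⟫ → ⟪a, x₀⟫` for every `a`. -/
def WeaklyConvergesTo {H : Type*} [NormedAddCommGroup H] [InnerProductSpace ℝ H]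
    (x : ℕ → H) (x₀ : H) : Prop :=
  ∀ a : H, Tendsto (fun k => ⟪a, x k⟫) atTop (𝓝 ⟪a, x₀⟫)

/-- The quadratic form `x ↦ ⟪x, T x⟫` is a Legendre form: it is weakly sequentially lower
semicontinuous, and `x k → x₀` strongly whenever `x k ⇀ x₀` and `⟪x k, T (x k)⟫ → ⟪x₀, T x₀⟫`. -/
def IsLegendreForm {H : Type*} [NormedAddCommGroup H] [InnerProductSpace ℝ H]
    (T : H →L[ℝ] H) : Prop :=
  (∀ (x : ℕ → H) (x₀ : H), WeaklyConvergesTo x x₀ →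
      ⟪x₀, T x₀⟫ ≤ Filter.liminf (fun k => ⟪x k, T (x k)⟫) Filter.atTop) ∧
  (∀ (x : ℕ → H) (x₀ : H), WeaklyConvergesTo x x₀ →
      Tendsto (fun k => ⟪x k, T (x k)⟫) atTop (𝓝 ⟪x₀, T x₀⟫) →
      Tendsto x atTop (𝓝 x₀))

section WeakConvergence

variable {H : Type*} [NormedAddCommGroup H] [InnerProductSpace ℝ H]

/-- Bounded sequences in a Hilbert space have weakly convergent subsequences. -/
theorem exists_subseq_weaklyConvergesTo [CompleteSpace H] (x : ℕ → H) (M : ℝ)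
    (hM : ∀ k, ‖x k‖ ≤ M) :
    ∃ (x₀ : H) (φ : ℕ → ℕ), StrictMono φ ∧ WeaklyConvergesTo (x ∘ φ) x₀ := by
  set K : Submodule ℝ H := (Submodule.span ℝ (Set.range x)).topologicalClosure with hK
  have hsep : TopologicalSpace.IsSeparable (K : Set H) := by
    rw [hK, Submodule.topologicalClosure_coe]
    exact ((Set.countable_range x).isSeparable.span (R := ℝ)).closure
  have : TopologicalSpace.SeparableSpace K := hsep.separableSpace
  have : CompleteSpace K :=
    (Submodule.isClosed_topologicalClosure _).completeSpace_coe
  have hxK : ∀ k, x k ∈ K := fun k =>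
    Submodule.le_topologicalClosure _ (Submodule.subset_span ⟨k, rfl⟩)
  let y : ℕ → K := fun k => ⟨x k, hxK k⟩
  let l : ℕ → WeakDual ℝ K := fun k => StrongDual.toWeakDual (InnerProductSpace.toDual ℝ K (y k))
  have hl : ∀ k, l k ∈ WeakDual.toStrongDual ⁻¹' Metric.closedBall (0 : StrongDual ℝ K) M := by
    intro k
    have : ‖InnerProductSpace.toDual ℝ K (y k)‖ ≤ M := by
      rw [LinearIsometryEquiv.norm_map]
      exact hM k
    exact mem_closedBall_zero_iff.2 this
  obtain ⟨a, -, φ, hφ, hlim⟩ := WeakDual.isSeqCompact_closedBall ℝ K 0 M hl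
  refine ⟨((InnerProductSpace.toDual ℝ K).symm (WeakDual.toStrongDual a) : K), φ, hφ, ?_⟩
  intro b
  have h1 := ((WeakDual.eval_continuous (𝕜 := ℝ) (E := K)
    (K.orthogonalProjectionOnto b)).tendsto a).comp hlim
  have h2 : ∀ z : K, ⟪b, (z : H)⟫ = ⟪z, K.orthogonalProjectionOnto b⟫ := by
    intro z
    rw [real_inner_comm]
    exact (Submodule.inner_orthogonalProjectionOnto_eq_of_mem_left z b).symm
  rw [h2, InnerProductSpace.toDual_symm_apply]
  refine h1.congr fun k => ?_
  exact (h2 (y (φ k))).symm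

theorem WeaklyConvergesTo.exists_norm_le [CompleteSpace H] {x : ℕ → H} {x₀ : H}
    (h : WeaklyConvergesTo x x₀) : ∃ M, ∀ k, ‖x k‖ ≤ M := by
  obtain ⟨M, hM⟩ := banach_steinhaus (g := fun k => innerSL ℝ (x k)) (fun a => by
    obtain ⟨C, hC⟩ := (h a).norm.bddAbove_range
    exact ⟨C, fun k => by
      rw [innerSL_apply_apply, real_inner_comm]
      exact hC ⟨k, rfl⟩⟩)
  exact ⟨M, fun k => by simpa using hM k⟩

theorem WeaklyConvergesTo.exists_abs_form_le [CompleteSpace H] {x : ℕ → H} {x₀ : H}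
    (h : WeaklyConvergesTo x x₀) (T : H →L[ℝ] H) : ∃ C, ∀ k, |⟪x k, T (x k)⟫| ≤ C := by
  obtain ⟨M, hM⟩ := h.exists_norm_le
  refine ⟨M * (‖T‖ * M), fun k => (abs_real_inner_le_norm _ _).trans ?_⟩
  have hM0 := (norm_nonneg _).trans (hM k)
  have := T.le_opNorm_of_le (hM k)
  gcongr
  exact hM k

theorem IsLegendreForm.eventually_lt [CompleteSpace H] {T : H →L[ℝ] H} (hT : IsLegendreForm T)
    {x : ℕ → H} {x₀ : H} (h : WeaklyConvergesTo x x₀) {r : ℝ} (hr : r < ⟪x₀, T x₀⟫) :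
    ∀ᶠ k in atTop, r < ⟪x k, T (x k)⟫ := by
  obtain ⟨C, hC⟩ := h.exists_abs_form_le T
  refine eventually_lt_of_lt_liminf (hr.trans_le (hT.1 x x₀ h)) ?_
  exact isBoundedUnder_of_eventually_ge (Eventually.of_forall fun k => (abs_le.1 (hC k)).1)

theorem IsLegendreForm.form_le_of_tendsto [CompleteSpace H] {T : H →L[ℝ] H}
    (hT : IsLegendreForm T) {x : ℕ → H} {x₀ : H} (h : WeaklyConvergesTo x x₀) {a : ℕ → ℝ} {A : ℝ}
    (hle : ∀ k, ⟪x k, T (x k)⟫ ≤ a k) (ha : Tendsto a atTop (𝓝 A)) : ⟪x₀, T x₀⟫ ≤ A :=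
  le_of_forall_lt_imp_le_of_dense fun _ hr => ge_of_tendsto ha
    ((hT.eventually_lt h hr).mono fun k hk => hk.le.trans (hle k))

theorem IsLegendreForm.tendsto_of_form_le [CompleteSpace H] {T : H →L[ℝ] H}
    (hT : IsLegendreForm T) {x : ℕ → H} {x₀ : H} (h : WeaklyConvergesTo x x₀) {a : ℕ → ℝ}
    (hle : ∀ k, ⟪x k, T (x k)⟫ ≤ a k) (ha : Tendsto a atTop (𝓝 ⟪x₀, T x₀⟫)) :
    Tendsto x atTop (𝓝 x₀) :=
  hT.2 x x₀ h <| tendsto_order.2 ⟨fun _ hr => hT.eventually_lt h hr, fun _ hr =>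
    ((tendsto_order.1 ha).2 _ hr).mono fun k hk => (hle k).trans_lt hk⟩

theorem form_add_smul {T : H →L[ℝ] H} (hT : ∀ x y : H, ⟪T x, y⟫ = ⟪x, T y⟫) (x v : H) (t : ℝ) :
    ⟪x + t • v, T (x + t • v)⟫ = ⟪x, T x⟫ + 2 * t * ⟪T x, v⟫ + t ^ 2 * ⟪v, T v⟫ := by
  have h1 : ⟪x, T v⟫ = ⟪T x, v⟫ := (hT x v).symm
  have h2 : ⟪v, T x⟫ = ⟪T x, v⟫ := real_inner_comm _ _
  simp only [map_add, map_smul, inner_add_left, inner_add_right, real_inner_smul_left,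
    real_inner_smul_right, h1, h2]
  ring

theorem form_ge_tangent {T : H →L[ℝ] H} (hT : ∀ x y : H, ⟪T x, y⟫ = ⟪x, T y⟫)
    (hpos : ∀ x, 0 ≤ ⟪x, T x⟫) (x₀ x : H) :
    2 * ⟪T x₀, x⟫ - ⟪x₀, T x₀⟫ ≤ ⟪x, T x⟫ := by
  have h := form_add_smul hT x x₀ (-1)
  have h1 := hpos (x + (-1 : ℝ) • x₀)
  have h2 : ⟪T x, x₀⟫ = ⟪T x₀, x⟫ := by rw [hT, real_inner_comm]
  rw [h2] at h
  linarith

theorem form_le_of_tendsto_of_nonneg {T : H →L[ℝ] H} (hT : ∀ x y : H, ⟪T x, y⟫ = ⟪x, T y⟫)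
    (hpos : ∀ x, 0 ≤ ⟪x, T x⟫) {x : ℕ → H} {x₀ : H} (h : WeaklyConvergesTo x x₀) {a : ℕ → ℝ}
    {A : ℝ} (hle : ∀ k, ⟪x k, T (x k)⟫ ≤ a k) (ha : Tendsto a atTop (𝓝 A)) : ⟪x₀, T x₀⟫ ≤ A := by
  have h1 := le_of_tendsto_of_tendsto' (((h (T x₀)).const_mul 2).sub_const ⟪x₀, T x₀⟫) ha
    fun k => (form_ge_tangent hT hpos x₀ (x k)).trans (hle k)
  rw [hT x₀ x₀] at h1
  linarith

/-- Adding a positive semidefinite operator preserves the Legendre property. -/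
theorem IsLegendreForm.add_nonneg [CompleteSpace H] {T P : H →L[ℝ] H} (hT : IsLegendreForm T)
    (hP : ∀ x y : H, ⟪P x, y⟫ = ⟪x, P y⟫) (hpos : ∀ x, 0 ≤ ⟪x, P x⟫) :
    IsLegendreForm (T + P) := by
  have hsum : ∀ x : H, ⟪x, (T + P) x⟫ = ⟪x, T x⟫ + ⟪x, P x⟫ := fun x => by
    simp [inner_add_right]
  have htan : ∀ (x : ℕ → H) (x₀ : H), WeaklyConvergesTo x x₀ →
      Tendsto (fun k => 2 * ⟪P x₀, x k⟫ - ⟪x₀, P x₀⟫) atTop (𝓝 ⟪x₀, P x₀⟫) := by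
    intro x x₀ h
    have := ((h (P x₀)).const_mul 2).sub_const ⟪x₀, P x₀⟫
    rw [hP x₀ x₀] at this
    convert this using 2
    ring
  constructor
  · intro x x₀ h
    obtain ⟨C, hC⟩ := h.exists_abs_form_le (T + P)
    have hb : IsCoboundedUnder (· ≥ ·) atTop (fun k => ⟪x k, (T + P) (x k)⟫) :=
      (isBoundedUnder_of_eventually_le (a := C)
        (Eventually.of_forall fun k => (abs_le.1 (hC k)).2)).isCoboundedUnder_ge
    refine le_of_forall_lt_imp_le_of_dense fun r hr => le_liminf_of_le hb ?_
    rw [hsum] at hr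
    set ε := (⟪x₀, T x₀⟫ + ⟪x₀, P x₀⟫ - r) / 2 with hε
    filter_upwards [hT.eventually_lt h (r := ⟪x₀, T x₀⟫ - ε) (by linarith),
      (tendsto_order.1 (htan x x₀ h)).1 (⟪x₀, P x₀⟫ - ε) (by linarith)] with k h1 h2
    have h3 := form_ge_tangent hP hpos x₀ (x k)
    rw [hsum]
    linarith
  · intro x x₀ h hlim
    refine hT.tendsto_of_form_le h (fun k => ?_)
      ((hlim.sub (htan x x₀ h)).trans (by rw [hsum, add_sub_cancel_right]))
    have h3 := form_ge_tangent hP hpos x₀ (x k)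
    rw [hsum]
    linarith

end WeakConvergence

section RealInequalities

theorem quadratic_coeff_nonneg {a b d m : ℝ} (h : ∀ t : ℝ, 0 ≤ t → m ≤ a + b * t + d * t ^ 2) :
    0 ≤ d := by
  by_contra! hd
  have hd' : 0 < -d := by linarith
  have h1 := h (1 + (|a| + |b| + |m|) / (-d)) (by positivity)
  set s := (|a| + |b| + |m|) / (-d) with hs
  have hs0 : 0 ≤ s := by positivity
  have h2 : d * s = -(|a| + |b| + |m|) := by
    rw [hs, div_neg, mul_neg, mul_div_cancel₀ _ hd.ne]
  have h3 := le_abs_self a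
  have h4 := le_abs_self b
  have h5 := neg_abs_le m
  have h6 : d * (1 + s) ^ 2 = d * (1 + s) - (|a| + |b| + |m|) * (1 + s) := by
    linear_combination (1 + s) * h2
  nlinarith [mul_nonneg (sub_nonneg.2 h4) (add_nonneg zero_le_one hs0),
    mul_nonneg (abs_nonneg a) hs0, mul_nonneg (abs_nonneg m) hs0]

theorem linear_coeff_nonneg {a b m : ℝ} (h : ∀ t : ℝ, 0 ≤ t → m ≤ a + b * t) : 0 ≤ b := by
  by_contra! hb
  have h0 := h 0 le_rfl
  have h1 := h ((a - m + 1) / (-b)) (div_nonneg (by linarith) (by linarith))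
  have h2 : b * ((a - m + 1) / (-b)) = -(a - m + 1) := by
    rw [div_neg, mul_neg, mul_div_cancel₀ _ hb.ne]
  linarith

theorem exists_forall_le_add {X : Type*} {S : Set X} (hS : S.Nonempty) {φ : X → ℝ} {m : ℝ}
    (hm : ∀ x ∈ S, m ≤ φ x) {ε : ℝ} (hε : 0 < ε) : ∃ x ∈ S, ∀ y ∈ S, φ x ≤ φ y + ε := by
  have hbd : BddBelow (φ '' S) := ⟨m, by rintro _ ⟨x, hx, rfl⟩; exact hm x hx⟩
  obtain ⟨_, ⟨x, hx, rfl⟩, h⟩ := exists_lt_of_csInf_lt (hS.image φ) (lt_add_of_pos_right _ hε)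
  exact ⟨x, hx, fun y hy => by linarith [csInf_le hbd ⟨y, hy, rfl⟩]⟩

end RealInequalities

section Quadratic

variable {H : Type*} [NormedAddCommGroup H] [InnerProductSpace ℝ H]

theorem map_eq_zero_of_form_nonpos {T : H →L[ℝ] H} (hT : ∀ x y : H, ⟪T x, y⟫ = ⟪x, T y⟫)
    (hpos : ∀ x, 0 ≤ ⟪x, T x⟫) {v : H} (hv : ⟪v, T v⟫ ≤ 0) : T v = 0 := by
  have hv0 : ⟪v, T v⟫ = 0 := le_antisymm hv (hpos v)
  have h : ∀ t : ℝ, 0 ≤ t → -⟪T v, T (T v)⟫ ≤ 0 + (-2 * ⟪T v, T v⟫) * t := by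
    intro t _
    have h1 := form_add_smul hT (T v) v (-t)
    have h2 := hpos (T v + (-t) • v)
    rw [hv0, hT (T v) v] at h1
    linarith
  have h1 := linear_coeff_nonneg h
  exact real_inner_self_nonpos.1 (by linarith : ⟪T v, T v⟫ ≤ 0)

/-- The function `x ↦ ½⟪x, T x⟫ + ⟪c, x⟫`. -/
noncomputable def quadFun (T : H →L[ℝ] H) (c x : H) : ℝ := (1/2 : ℝ) * ⟪x, T x⟫ + ⟪c, x⟫

theorem quadFun_add_smul {T : H →L[ℝ] H} (hT : ∀ x y : H, ⟪T x, y⟫ = ⟪x, T y⟫) (c x v : H)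
    (t : ℝ) : quadFun T c (x + t • v) =
      quadFun T c x + (⟪T x, v⟫ + ⟪c, v⟫) * t + ((1/2 : ℝ) * ⟪v, T v⟫) * t ^ 2 := by
  simp only [quadFun, form_add_smul hT, inner_add_right, real_inner_smul_right]
  ring

theorem quadFun_add_smul_of_map_eq_zero {T : H →L[ℝ] H} (hT : ∀ x y : H, ⟪T x, y⟫ = ⟪x, T y⟫)
    (c x : H) {v : H} (hv : T v = 0) (t : ℝ) :
    quadFun T c (x + t • v) = quadFun T c x + ⟪c, v⟫ * t := by
  simp [quadFun_add_smul hT, hT, hv]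

theorem form_normalize_le (T : H →L[ℝ] H) {c x : H} {C : ℝ} (h : quadFun T c x ≤ C) :
    ⟪‖x‖⁻¹ • x, T (‖x‖⁻¹ • x)⟫ ≤ 2 * ‖x‖⁻¹ ^ 2 * C - 2 * ‖x‖⁻¹ * ⟪c, ‖x‖⁻¹ • x⟫ := by
  simp only [map_smul, real_inner_smul_left, real_inner_smul_right]
  have := mul_le_mul_of_nonneg_left h (by positivity : 0 ≤ 2 * ‖x‖⁻¹ ^ 2)
  simp only [quadFun] at this
  linarith

/-- Either a Legendre quadratic function attains its infimum on a convex quadratic sublevel set,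
or there is a direction in the kernel of the constraint operator that is isotropic for `T` and
strictly decreases the constraint function. -/
theorem exists_minimizer_or_descent_direction [CompleteSpace H]
    {T : H →L[ℝ] H} (hT : ∀ x y : H, ⟪T x, y⟫ = ⟪x, T y⟫) (hLeg : IsLegendreForm T) (c : H)
    {T₁ : H →L[ℝ] H} (hT₁ : ∀ x y : H, ⟪T₁ x, y⟫ = ⟪x, T₁ y⟫)
    (hpos : ∀ x : H, 0 ≤ ⟪x, T₁ x⟫) (c₁ : H) (α : ℝ)
    (hne : ∃ x, quadFun T₁ c₁ x ≤ α) {m : ℝ}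
    (hbd : ∀ x, quadFun T₁ c₁ x ≤ α → m ≤ quadFun T c x) :
    (∃ x, quadFun T₁ c₁ x ≤ α ∧ ∀ y, quadFun T₁ c₁ y ≤ α → quadFun T c x ≤ quadFun T c y) ∨
    ∃ v, T₁ v = 0 ∧ ⟪c₁, v⟫ < 0 ∧ ⟪v, T v⟫ = 0 := by
  have hseq : ∀ k : ℕ, ∃ x, (quadFun T₁ c₁ x ≤ α ∧ ∀ y, quadFun T₁ c₁ y ≤ α →
      quadFun T c x ≤ quadFun T c y + 1 / ((k : ℝ) + 1)) ∧
      ∀ y, quadFun T₁ c₁ y ≤ α → quadFun T c y ≤ quadFun T c x → ‖x‖ ≤ ‖y‖ + 1 / 2 := by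
    intro k
    obtain ⟨x, hx, hx'⟩ := exists_forall_le_add (S := {x | quadFun T₁ c₁ x ≤ α}) hne
      (φ := quadFun T c) hbd (ε := 1 / ((k : ℝ) + 1)) (by positivity)
    obtain ⟨z, hz, hz'⟩ := exists_forall_le_add (S := {x | quadFun T₁ c₁ x ≤ α ∧
      ∀ y, quadFun T₁ c₁ y ≤ α → quadFun T c x ≤ quadFun T c y + 1 / ((k : ℝ) + 1)})
      ⟨x, hx, hx'⟩ (φ := norm) (fun x _ => norm_nonneg x) (ε := 1 / 2) (by norm_num)
    exact ⟨z, hz, fun y hy hyz => hz' y ⟨hy, fun w hw => hyz.trans (hz.2 w hw)⟩⟩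
  choose x hx hmin using hseq
  by_cases hb : ∃ M, ∃ᶠ k in atTop, ‖x k‖ ≤ M
  · left
    obtain ⟨M, hM⟩ := hb
    obtain ⟨φ, hφ, hφM⟩ := extraction_of_frequently_atTop hM
    obtain ⟨x₀, ψ, hψ, hw⟩ := exists_subseq_weaklyConvergesTo (x ∘ φ) M hφM
    refine ⟨x₀, ?_, fun y hy => ?_⟩
    · have := form_le_of_tendsto_of_nonneg hT₁ hpos hw
        (a := fun k => 2 * α - 2 * ⟪c₁, ((x ∘ φ) ∘ ψ) k⟫)
        (fun k => by
          have := (hx (φ (ψ k))).1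
          simp only [quadFun] at this
          simp only [Function.comp_apply]
          linarith) (((hw c₁).const_mul 2).const_sub _)
      simp only [quadFun]
      linarith
    · have h0 := tendsto_one_div_add_atTop_nhds_zero_nat (𝕜 := ℝ).comp
        (hφ.tendsto_atTop.comp hψ.tendsto_atTop)
      have := hLeg.form_le_of_tendsto hw
        (a := fun k => 2 * (quadFun T c y + 1 / ((φ (ψ k) : ℝ) + 1)) -
          2 * ⟪c, ((x ∘ φ) ∘ ψ) k⟫)
        (fun k => by
          have := (hx (φ (ψ k))).2 y hy
          simp only [quadFun] at this
          simp only [Function.comp_apply, quadFun]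
          linarith) (((h0.const_add (quadFun T c y)).const_mul 2).sub ((hw c).const_mul 2))
      rw [quadFun]
      linarith
  · right
    have htop : Tendsto (fun k => ‖x k‖) atTop atTop := by
      refine tendsto_atTop.2 fun M => ?_
      push Not at hb
      exact (hb M).mono fun k hk => hk.le
    obtain ⟨v, φ, hφ, hw⟩ := exists_subseq_weaklyConvergesTo (fun k => ‖x k‖⁻¹ • x k) 1
      (fun k => by
        rw [norm_smul, norm_inv, norm_norm]
        exact inv_mul_le_one)
    have hr : Tendsto (fun k => ‖x (φ k)‖⁻¹) atTop (𝓝 0) :=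
      tendsto_inv_atTop_zero.comp (htop.comp hφ.tendsto_atTop)
    have hlim : ∀ (C : ℝ) (d : H), Tendsto (fun k => 2 * ‖x (φ k)‖⁻¹ ^ 2 * C -
        2 * ‖x (φ k)‖⁻¹ * ⟪d, ‖x (φ k)‖⁻¹ • x (φ k)⟫) atTop (𝓝 0) := by
      intro C d
      have := (((hr.pow 2).const_mul 2).mul_const C).sub ((hr.const_mul 2).mul (hw d))
      simpa using this
    have hT₁v : T₁ v = 0 := map_eq_zero_of_form_nonpos hT₁ hpos
      (form_le_of_tendsto_of_nonneg hT₁ hpos hw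
        (fun k => form_normalize_le T₁ (hx (φ k)).1) (hlim α c₁))
    have hc₁v : ⟪c₁, v⟫ ≤ 0 := by
      have h1 : Tendsto (fun k => ‖x (φ k)‖⁻¹ * α) atTop (𝓝 0) := by simpa using hr.mul_const α
      refine le_of_tendsto_of_tendsto' (hw c₁) h1 fun k => ?_
      have h2 := (hx (φ k)).1
      have h3 := hpos (x (φ k))
      simp only [quadFun] at h2
      simp only [Function.comp_apply, real_inner_smul_right]
      gcongr
      linarith
    have hrec : ∀ y, quadFun T₁ c₁ y ≤ α → ∀ t : ℝ, 0 ≤ t → m ≤ quadFun T c y +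
        (⟪T y, v⟫ + ⟪c, v⟫) * t + ((1/2 : ℝ) * ⟪v, T v⟫) * t ^ 2 := by
      intro y hy t ht
      rw [← quadFun_add_smul hT]
      apply hbd
      rw [quadFun_add_smul_of_map_eq_zero hT₁ _ _ hT₁v]
      nlinarith
    obtain ⟨y, hy⟩ := hne
    have hle : ∀ k, quadFun T c (x (φ k)) ≤ quadFun T c y + 1 := fun k =>
      ((hx (φ k)).2 y hy).trans (by
        gcongr
        rw [div_le_one (by positivity)]
        linarith [(φ k).cast_nonneg (α := ℝ)])
    have hform : ∀ k, ⟪((fun k => ‖x k‖⁻¹ • x k) ∘ φ) k, T (((fun k => ‖x k‖⁻¹ • x k) ∘ φ) k)⟫ ≤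
        2 * ‖x (φ k)‖⁻¹ ^ 2 * (quadFun T c y + 1) -
        2 * ‖x (φ k)‖⁻¹ * ⟪c, ‖x (φ k)‖⁻¹ • x (φ k)⟫ := fun k => form_normalize_le T (hle k)
    have hv0 : ⟪v, T v⟫ = 0 := le_antisymm (hLeg.form_le_of_tendsto hw hform (hlim _ c))
      (by linarith [quadratic_coeff_nonneg (hrec y hy)])
    have hstrong := hLeg.tendsto_of_form_le hw hform (by rw [hv0]; exact hlim _ c)
    have hlarge : ∀ᶠ k in atTop, 1 ≤ ‖x (φ k)‖ :=
      (htop.comp hφ.tendsto_atTop).eventually_ge_atTop 1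
    have hv1 : ‖v‖ = 1 := by
      refine tendsto_nhds_unique hstrong.norm (tendsto_const_nhds.congr' ?_)
      filter_upwards [hlarge] with k hk
      simp only [Function.comp_apply, norm_smul, norm_inv, norm_norm]
      rw [inv_mul_cancel₀ (by linarith)]
    refine ⟨v, hT₁v, lt_of_le_of_ne hc₁v fun hc0 => ?_, hv0⟩
    have hlimit : ⟪v, v⟫ ≤ 1 / 2 + 0 := by
      refine le_of_tendsto_of_tendsto (hw v) (hr.const_add (1 / 2)) ?_
      filter_upwards [hlarge] with k hk
      have hfeas : quadFun T₁ c₁ (x (φ k) + (-1 : ℝ) • v) ≤ α := by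
        rw [quadFun_add_smul_of_map_eq_zero hT₁ _ _ hT₁v, hc0, zero_mul, add_zero]
        exact (hx (φ k)).1
      have hslope : 0 ≤ ⟪T (x (φ k)), v⟫ + ⟪c, v⟫ := by
        refine linear_coeff_nonneg (a := quadFun T c (x (φ k))) (m := m) fun t ht => ?_
        simpa [hv0] using hrec _ (hx (φ k)).1 t ht
      have h1 := hmin (φ k) _ hfeas (by
        rw [quadFun_add_smul hT, hv0]
        linarith)
      have h2 : ‖x (φ k) + (-1 : ℝ) • v‖ ^ 2 = ‖x (φ k)‖ ^ 2 - 2 * ⟪v, x (φ k)⟫ + 1 := by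
        rw [neg_one_smul, ← sub_eq_add_neg, norm_sub_sq_real, hv1, real_inner_comm]
        ring
      have h3 : ⟪v, x (φ k)⟫ ≤ 1 / 2 * ‖x (φ k)‖ + 1 := by
        nlinarith [norm_nonneg (x (φ k) + (-1 : ℝ) • v)]
      have h4 := mul_le_mul_of_nonneg_left h3 (inv_nonneg.2 (norm_nonneg (x (φ k))))
      have h5 : ‖x (φ k)‖⁻¹ * ‖x (φ k)‖ = 1 := inv_mul_cancel₀ (by linarith)
      simp only [Function.comp_apply, real_inner_smul_right]
      linarith
    rw [real_inner_self_eq_norm_sq, hv1] at hlimit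
    norm_num at hlimit

/-- A Legendre quadratic function that is bounded below on the whole space attains its minimum. -/
theorem exists_minimizer_of_bddBelow [CompleteSpace H]
    {T : H →L[ℝ] H} (hT : ∀ x y : H, ⟪T x, y⟫ = ⟪x, T y⟫) (hLeg : IsLegendreForm T) (c : H)
    {m : ℝ} (hbd : ∀ x, m ≤ quadFun T c x) : ∃ x, ∀ y, quadFun T c x ≤ quadFun T c y := by
  have h0 : ∀ x : H, quadFun (0 : H →L[ℝ] H) 0 x ≤ 0 := fun x => by simp [quadFun]
  obtain ⟨x, -, hx⟩ | ⟨v, -, hv, -⟩ := exists_minimizer_or_descent_direction hT hLeg c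
    (T₁ := 0) (by simp) (by simp) 0 0 ⟨0, h0 0⟩ (fun x _ => hbd x)
  · exact ⟨x, fun y => hx y (h0 y)⟩
  · simp at hv

theorem exists_minimizer_of_sublevel [CompleteSpace H]
    {T : H →L[ℝ] H} (hT : ∀ x y : H, ⟪T x, y⟫ = ⟪x, T y⟫) (hLeg : IsLegendreForm T) (c : H)
    {T₁ : H →L[ℝ] H} (hT₁ : ∀ x y : H, ⟪T₁ x, y⟫ = ⟪x, T₁ y⟫)
    (hpos : ∀ x : H, 0 ≤ ⟪x, T₁ x⟫) (c₁ : H) (α : ℝ)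
    (hne : ∃ x, quadFun T₁ c₁ x ≤ α) {m : ℝ}
    (hbd : ∀ x, quadFun T₁ c₁ x ≤ α → m ≤ quadFun T c x) :
    ∃ x, quadFun T₁ c₁ x ≤ α ∧ ∀ y, quadFun T₁ c₁ y ≤ α → quadFun T c x ≤ quadFun T c y := by
  obtain h | ⟨v, hT₁v, hc₁v, hv⟩ :=
    exists_minimizer_or_descent_direction hT hLeg c hT₁ hpos c₁ α hne hbd
  · exact h
  let s : H → ℝ := fun x => (α - quadFun T₁ c₁ x) / ⟪c₁, v⟫
  have hs : ∀ x, ⟪c₁, v⟫ * s x = α - quadFun T₁ c₁ x := fun x => mul_div_cancel₀ _ hc₁v.ne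
  have hshift : ∀ x (t : ℝ), 0 ≤ t → quadFun T₁ c₁ (x + (s x + t) • v) ≤ α := by
    intro x t ht
    rw [quadFun_add_smul_of_map_eq_zero hT₁ _ _ hT₁v, mul_add, hs]
    nlinarith
  have hslope : ∀ x, 0 ≤ ⟪T x, v⟫ + ⟪c, v⟫ := by
    intro x
    refine linear_coeff_nonneg (a := quadFun T c x + (⟪T x, v⟫ + ⟪c, v⟫) * s x) (m := m)
      fun t ht => ?_
    have h := hbd _ (hshift x t ht)
    rw [quadFun_add_smul hT, hv] at h
    linarith
  have hTv : T v = 0 := by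
    have h : ∀ t : ℝ, 0 ≤ t → -⟪c, v⟫ ≤ 0 + (-⟪T v, T v⟫) * t := by
      intro t _
      have h := hslope ((-t) • T v)
      rw [hT, real_inner_smul_left] at h
      linarith
    exact real_inner_self_nonpos.1 (by linarith [linear_coeff_nonneg h] : ⟪T v, T v⟫ ≤ 0)
  have hcv : 0 ≤ ⟪c, v⟫ := by simpa using hslope 0
  set μ : ℝ := ⟪c, v⟫ / (-⟪c₁, v⟫) with hμ
  have hμ0 : 0 ≤ μ := div_nonneg hcv (by linarith)
  have hμv : ⟪c, v⟫ = -(μ * ⟪c₁, v⟫) := by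
    rw [hμ]
    field_simp [hc₁v.ne]
  have hlag : ∀ x, quadFun (T + μ • T₁) (c + μ • c₁) x = quadFun T c x + μ * quadFun T₁ c₁ x := by
    intro x
    simp only [quadFun, add_apply, smul_apply, inner_add_right, inner_add_left,
      real_inner_smul_left, real_inner_smul_right]
    ring
  have hval : ∀ x, quadFun T c (x + (s x + 0) • v) =
      quadFun (T + μ • T₁) (c + μ • c₁) x - μ * α := by
    intro x
    rw [quadFun_add_smul_of_map_eq_zero hT _ _ hTv, hlag, hμv]
    linear_combination (-μ) * hs x
  have hP : ∀ x y : H, ⟪(μ • T₁) x, y⟫ = ⟪x, (μ • T₁) y⟫ := fun x y => by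
    simp [real_inner_smul_left, real_inner_smul_right, hT₁]
  obtain ⟨x, hx⟩ := exists_minimizer_of_bddBelow (T := T + μ • T₁) (c := c + μ • c₁) (m := m + μ * α)
    (fun x y => by
      rw [add_apply, add_apply, inner_add_left, inner_add_right, hT, hP])
    (hLeg.add_nonneg hP fun x => by
      simpa [real_inner_smul_right] using mul_nonneg hμ0 (hpos x))
    (fun x => by linarith [hbd _ (hshift x 0 le_rfl), hval x])
  refine ⟨_, hshift x 0 le_rfl, fun y hy => ?_⟩
  have h1 := hx y
  rw [hlag y] at h1
  rw [hval]
  nlinarith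

end Quadratic

/-- The single-constraint case (`m = 1`): if `⟪x, T x⟫` is a Legendre form, `F` (defined by
one convex quadratic inequality) is nonempty and `f` is bounded from below on `F`, then `f`
attains its infimum on `F`. -/
theorem frank_wolfe_single_constraint
    {H : Type*} [NormedAddCommGroup H] [InnerProductSpace ℝ H] [CompleteSpace H]
    (T : H →L[ℝ] H) (hT_sa : ∀ x y : H, ⟪T x, y⟫ = ⟪x, T y⟫) (c : H)
    (T₁ : H →L[ℝ] H) (hT₁_sa : ∀ x y : H, ⟪T₁ x, y⟫ = ⟪x, T₁ y⟫)
    (hT₁_pos : ∀ x : H, 0 ≤ ⟪x, T₁ x⟫)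
    (c₁ : H) (α₁ : ℝ)
    (f : H → ℝ) (hf : ∀ x, f x = (1/2 : ℝ) * ⟪x, T x⟫ + ⟪c, x⟫)
    (F : Set H)
    (hF : F = {x : H | (1/2 : ℝ) * ⟪x, T₁ x⟫ + ⟪c₁, x⟫ + α₁ ≤ 0})
    (hLeg : IsLegendreForm T)
    (hne : F.Nonempty) (hbd : BddBelow (f '' F)) :
    ∃ xbar ∈ F, ∀ x ∈ F, f xbar ≤ f x := by
  subst hF
  obtain ⟨m, hm⟩ := hbd
  obtain rfl : f = quadFun T c := funext hf
  have hmem : ∀ x, quadFun T₁ c₁ x ≤ -α₁ ↔ (1/2 : ℝ) * ⟪x, T₁ x⟫ + ⟪c₁, x⟫ + α₁ ≤ 0 := fun x => by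
    rw [quadFun, le_neg_iff_add_nonpos_right]
  obtain ⟨x₁, hx₁⟩ := hne
  obtain ⟨x, hx, hmin⟩ := exists_minimizer_of_sublevel hT_sa hLeg c hT₁_sa hT₁_pos c₁ (-α₁)
    ⟨x₁, (hmem x₁).2 hx₁⟩ (fun x hx => hm ⟨x, (hmem x).1 hx, rfl⟩)
  exact ⟨x, (hmem x).1 hx, fun y hy => hmin y ((hmem y).2 hy)⟩
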